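/- Let f : Z → X be a proper surjective morphism of schemes of finite type over a field, and suppose that for every integral closed subscheme W ⊆ X there exists an integral closed subscheme W' ⊆ Z such that f maps W' birationally onto W (i.e., f is an envelope). Then for any morphism g : X' → X, the base change f' : Z ×_X X' → X' is also an envelope. -/

import Mathlib

open CategoryTheory AlgebraicGeometry Limits

universe u

/-- A morphism of schemes is *birational onto its target* if it restricts to an
isomorphism over a dense open subset of the target. -/
def IsBirationalOnto {W' W : Scheme.{u}} (g : W' ⟶ W) : Prop :=
  ∃ U : W.Opens, Dense (U : Set W) ∧ IsIso (g ∣_ U)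

/-- A proper morphism `f : Z ⟶ X` is an *envelope* if every integral closed
subscheme `W` of `X` is the birational image of an integral closed subscheme
`W'` of `Z`. -/
def IsEnvelope {Z X : Scheme.{u}} (f : Z ⟶ X) : Prop :=
  IsProper f ∧
  ∀ (W : Scheme.{u}) (ι : W ⟶ X), IsClosedImmersion ι → IsIntegral W →
    ∃ (W' : Scheme.{u}) (ι' : W' ⟶ Z) (g : W' ⟶ W),
      IsClosedImmersion ι' ∧ IsIntegral W' ∧ ι' ≫ f = g ≫ ι ∧ IsBirationalOnto g

/-- A scheme `X` (with structure morphism `s`) is separated and of finite type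
over a field `k`. -/
def IsFiniteTypeOverField {X : Scheme.{u}} (k : Type u) [Field k]
    (s : X ⟶ Spec (CommRingCat.of k)) : Prop :=
  IsSeparated s ∧ LocallyOfFiniteType s ∧ QuasiCompact s

namespace AlgebraicGeometry

/-- The scheme-theoretic image of a reduced scheme is reduced. -/
lemma isReduced_image {X Y : Scheme.{u}} (f : X ⟶ Y) [QuasiCompact f] [IsReduced X] :
    IsReduced f.image := by
  let V (U : Y.affineOpens) : f.image.Opens := f.imageι ⁻¹ᵁ U.1
  have hV : TopologicalSpace.IsOpenCover V :=
    (TopologicalSpace.IsOpenCover.mk (iSup_affineOpens_eq_top Y)).comap f.imageι.base.hom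
  have (U : Y.affineOpens) : IsReduced (V U).toScheme := by
    have : IsAffine (V U).toScheme := U.2.preimage f.imageι
    have : _root_.IsReduced Γ(f.image, V U) :=
      isReduced_of_injective (f.toImage.app (V U)).hom (f.toImage_app_injective U)
    have : _root_.IsReduced Γ((V U).toScheme, ⊤) :=
      isReduced_of_injective (V U).topIso.hom.hom
        (V U).topIso.commRingCatIsoToRingEquiv.injective
    exact isReduced_of_isAffine_isReduced _
  have (U : Y.affineOpens) : IsReduced ((f.image.openCoverOfIsOpenCover V hV).X U) := this U
  exact @IsReduced.of_openCover _ (f.image.openCoverOfIsOpenCover V hV) this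

/-- The scheme-theoretic image of an integral scheme is integral. -/
lemma isIntegral_image {X Y : Scheme.{u}} (f : X ⟶ Y) [QuasiCompact f] [IsIntegral X] :
    IsIntegral f.image := by
  have := isReduced_image f
  have : IrreducibleSpace f.image := by
    rw [irreducibleSpace_def, Set.top_eq_univ, ← f.toImage.denseRange.closure_range,
      ← Set.image_univ]
    exact ((IrreducibleSpace.isIrreducible_univ X).image _
      f.toImage.continuous.continuousOn).closure
  exact isIntegral_of_irreducibleSpace_of_isReduced _

/-- Being an isomorphism over an open subset of the target is stable under base change. -/
lemma isIso_morphismRestrict_of_isPullback {P V' W V : Scheme.{u}} {a : P ⟶ V'} {p : P ⟶ W}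
    {q : V' ⟶ V} {t : W ⟶ V} (h : IsPullback a p q t) (U : V.Opens) [IsIso (q ∣_ U)] :
    IsIso (p ∣_ (t ⁻¹ᵁ U)) := by
  have h₁ := (isPullback_morphismRestrict p (t ⁻¹ᵁ U)).flip.paste_horiz h
  have h₂ : IsPullback ((p ⁻¹ᵁ t ⁻¹ᵁ U).ι ≫ a) (p ∣_ (t ⁻¹ᵁ U)) q ((t ∣_ U) ≫ U.ι) := by
    rw [morphismRestrict_ι]
    exact h₁
  exact MorphismProperty.of_isPullback (P := .isomorphisms Scheme.{u})
    (h₂.of_right' (isPullback_morphismRestrict q U).flip) ‹IsIso (q ∣_ U)›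

/-- Over an open subset, the scheme-theoretic image of that open subset is everything. -/
lemma isIso_imageι_morphismRestrict {P : Scheme.{u}} (O : P.Opens) :
    IsIso (O.ι.imageι ∣_ O) := by
  have h := isPullback_morphismRestrict O.ι.imageι O
  let s : O.toScheme ⟶ O.ι.imageι ⁻¹ᵁ O := h.lift (𝟙 _) O.ι.toImage (by simp)
  have hs : s ≫ O.ι.imageι ∣_ O = 𝟙 _ := h.lift_fst _ _ _
  have : IsSplitEpi (O.ι.imageι ∣_ O) := ⟨⟨s, hs⟩⟩
  exact isIso_of_mono_of_isSplitEpi _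

end AlgebraicGeometry

/-- **Envelopes are stable under base change.**
If `f : Z ⟶ X` is an envelope of schemes of finite type over a field `k` and
`g : X' ⟶ X` is any morphism, then the base change
`f' : Z ×_X X' ⟶ X'` is also an envelope. -/
theorem isEnvelope_of_baseChange
    (k : Type u) [Field k]
    {Z X X' : Scheme.{u}}
    (sZ : Z ⟶ Spec (CommRingCat.of k)) (sX : X ⟶ Spec (CommRingCat.of k))
    (sX' : X' ⟶ Spec (CommRingCat.of k))
    (hZ : IsFiniteTypeOverField k sZ) (hX : IsFiniteTypeOverField k sX)
    (hX' : IsFiniteTypeOverField k sX')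
    (f : Z ⟶ X) (hfs : f ≫ sX = sZ)
    (g : X' ⟶ X) (hgs : g ≫ sX = sX')
    (hf : IsEnvelope f) :
    IsEnvelope (pullback.snd f g) := by
  obtain ⟨hfp, hf⟩ := hf
  obtain ⟨_, _, _⟩ := hX
  obtain ⟨_, _, _⟩ := hX'
  refine ⟨inferInstance, fun W ι _ _ ↦ ?_⟩
  have : QuasiCompact (g ≫ sX) := by rwa [hgs]
  have : QuasiCompact g := .of_comp g sX
  let t := (ι ≫ g).toImage
  let j := (ι ≫ g).imageι
  have htj : t ≫ j = ι ≫ g := (ι ≫ g).toImage_imageι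
  obtain ⟨V', ι', q, _, _, hq, U, hU, _⟩ := hf _ j inferInstance (isIntegral_image (ι ≫ g))
  let a := pullback.fst (ι' ≫ f) (ι ≫ g)
  let p := pullback.snd (ι' ≫ f) (ι ≫ g)
  have hP : IsPullback a p q t :=
    ⟨⟨by simp [← cancel_mono j, a, p, ← hq, htj, pullback.condition]⟩,
      ⟨PullbackCone.isLimitOfFactors _ _ j q t hq.symm htj _
      (pullback.isLimit (ι' ≫ f) (ι ≫ g))⟩⟩
  let m : pullback (ι' ≫ f) (ι ≫ g) ⟶ pullback f g :=
    pullback.map _ _ _ _ ι' ι (𝟙 X) (by simp) (by simp)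
  have : MorphismProperty.IsStableUnderComposition @IsClosedImmersion.{u} :=
    ⟨fun _ _ _ _ ↦ inferInstance⟩
  have : IsClosedImmersion m :=
    MorphismProperty.pullbackMap (P := @IsClosedImmersion.{u})
      ‹_› ‹_› rfl rfl
  have hm : m ≫ pullback.snd f g = p ≫ ι := pullback.lift_snd _ _ _
  have hpU : IsIso (p ∣_ (t ⁻¹ᵁ U)) := isIso_morphismRestrict_of_isPullback hP U
  have : Nonempty (ι ≫ g).image := ⟨t (genericPoint W)⟩
  obtain ⟨_, hxU, x, rfl⟩ := t.denseRange.inter_open_nonempty U U.isOpen hU.nonempty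
  have : Nonempty (t ⁻¹ᵁ U).toScheme := ⟨⟨x, hxU⟩⟩
  let O := p ⁻¹ᵁ t ⁻¹ᵁ U
  have : Nonempty O.toScheme := ⟨inv (p ∣_ (t ⁻¹ᵁ U)) ⟨x, hxU⟩⟩
  have : IsIntegral O.toScheme := isIntegral_of_isOpenImmersion (p ∣_ (t ⁻¹ᵁ U))
  have : IsLocallyNoetherian X' := LocallyOfFiniteType.isLocallyNoetherian sX'
  have : IsLocallyNoetherian (pullback (ι' ≫ f) (ι ≫ g)) :=
    LocallyOfFiniteType.isLocallyNoetherian (p ≫ ι)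
  refine ⟨O.ι.image, O.ι.imageι ≫ m, O.ι.imageι ≫ p, inferInstance, isIntegral_image _,
    by simp [hm], t ⁻¹ᵁ U, (t ⁻¹ᵁ U).isOpen.dense ⟨x, hxU⟩, ?_⟩
  rw [morphismRestrict_comp]
  have : IsIso (O.ι.imageι ∣_ p ⁻¹ᵁ t ⁻¹ᵁ U) := isIso_imageι_morphismRestrict O
  exact IsIso.comp_isIso' this hpU
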